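/- Let K be a field, n ≥ 3, and let S_n be the monoid presented by generators a_1, …, a_n and relations a_1 a_2 ⋯ a_n = a_{σ(1)} ⋯ a_{σ(n)} for σ in the cyclic group generated by the n-cycle. Let P = (a_1 ⋯ a_n)·S_n. Then the quotient ring K[S_n]/K[P] is both left and right primitive, i.e. it admits a faithful simple left module and a faithful simple right module. -/

import Mathlib

/-- The word `a_{σ(1)} a_{σ(2)} ⋯ a_{σ(n)}` in the free monoid on `n` generators. -/
def permWord (n : ℕ) (σ : Equiv.Perm (Fin n)) : FreeMonoid (Fin n) :=
  ((List.finRange n).map fun i => FreeMonoid.of (σ i)).prod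

/-- The defining relations `a_1 a_2 ⋯ a_n = a_{σ(1)} a_{σ(2)} ⋯ a_{σ(n)}`, where `σ` runs
through the cyclic subgroup of `Sym_n` generated by the `n`-cycle `(1,2,…,n)` (i.e. `finRotate n`). -/
def cycRel (n : ℕ) : FreeMonoid (Fin n) → FreeMonoid (Fin n) → Prop :=
  fun x y => x = permWord n 1 ∧ ∃ k : ℕ, y = permWord n (finRotate n ^ k)

/-- The monoid `S_n` presented by generators `a_1, …, a_n` and the above relations. -/
def Scyc (n : ℕ) : Type := (conGen (cycRel n)).Quotient

instance (n : ℕ) : Monoid (Scyc n) := Con.monoid _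

/-- The generator `a_i` of `S_n`. -/
def agen {n : ℕ} (i : Fin n) : Scyc n := (conGen (cycRel n)).mk' (FreeMonoid.of i)

/-- The element `z = a_1 a_2 ⋯ a_n` of `S_n`. -/
def zc (n : ℕ) : Scyc n := ((List.finRange n).map agen).prod

namespace CyclicMonoid

/-- `w` is a run of consecutive letters `x, x + 1, x + 2, …` (modulo the number of letters). -/
abbrev Asc {N : ℕ} (w : List (Fin (N + 3))) : Prop :=
  w.IsChain fun x y => y = x + 1

/-- `w` has no factor among the cyclic rotations of `a_1 ⋯ a_n`, where `n = N + 3`. -/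
def AscFree {N : ℕ} (w : List (Fin (N + 3))) : Prop :=
  ∀ r, r <:+: w → Asc r → r.length < N + 3

/-- The words that are concatenated in `longWord`. -/
def Block {N : ℕ} (w : List (Fin (N + 3))) : Prop :=
  AscFree w ∧ ∃ x u, w = x :: (u ++ [1, 0]) ∧ x ≠ 0 ∧ x ≠ 1

section Words

variable {N : ℕ}

lemma AscFree.of_infix {v w : List (Fin (N + 3))} (hw : AscFree w) (h : v <:+: w) : AscFree v :=
  fun r hr hc => hw r (hr.trans h) hc

lemma AscFree.append {v w : List (Fin (N + 3))} (hv : AscFree v) (hw : AscFree w)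
    (h : ∀ x ∈ v.getLast?, ∀ y ∈ w.head?, y ≠ x + 1) : AscFree (v ++ w) := by
  intro r hr hc
  rcases List.infix_append_iff.1 hr with h1 | h1 | ⟨r₁, r₂, rfl, ⟨s₁, rfl⟩, ⟨s₂, rfl⟩⟩
  · exact hv r h1 hc
  · exact hw r h1 hc
  · rcases r₁.eq_nil_or_concat with rfl | ⟨t₁, x, rfl⟩
    · exact hw _ (by simpa using List.infix_append_left) hc
    · rcases r₂ with _ | ⟨y, t₂⟩
      · exact hv _ (by simpa using List.infix_append_right) hc
      · have := (List.isChain_append.1 hc).2.2 x (by simp) y (by simp)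
        exact absurd this (h x (by simp [List.getLast?_append]) y (by simp))

lemma AscFree.of_length_lt {w : List (Fin (N + 3))} (hw : w.length < N + 3) : AscFree w :=
  fun _ hr _ => hr.length_le.trans_lt hw

lemma two_ne_zero' : (2 : Fin (N + 3)) ≠ 0 := by
  simp [Fin.ext_iff, Nat.mod_eq_of_lt (show 2 < N + 3 by omega)]

lemma two_ne_one' : (2 : Fin (N + 3)) ≠ 1 := by
  simp [Fin.ext_iff, Nat.mod_eq_of_lt (show 2 < N + 3 by omega)]

lemma zero_ne_one_add_one : (0 : Fin (N + 3)) ≠ 1 + 1 := by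
  simp [Fin.ext_iff, Fin.val_add, Nat.mod_eq_of_lt (show 2 < N + 3 by omega)]

lemma ne_add_one (x : Fin (N + 3)) : x ≠ x + 1 := by
  simp

lemma block_nonempty : Nonempty {w : List (Fin (N + 3)) // Block w} := by
  refine ⟨[2, 1, 0], ?_, 2, [], rfl, two_ne_zero', two_ne_one'⟩
  refine AscFree.append (v := [2, 1]) (w := [0]) (.of_length_lt (by simp))
    (.of_length_lt (by simp)) ?_
  simpa using zero_ne_one_add_one

lemma AscFree.exists_block {w : List (Fin (N + 3))} (hw : AscFree w) (hne : w ≠ []) :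
    ∃ b, Block b ∧ w <:+: b := by
  obtain ⟨s, hs⟩ : ∃ s, w.head? = some s := ⟨_, List.head?_eq_some_head hne⟩
  obtain ⟨e, he⟩ : ∃ e, w.getLast? = some e := ⟨_, List.getLast?_eq_some_getLast hne⟩
  refine ⟨[2, s] ++ w ++ [e, 1] ++ [0], ⟨?_, 2, s :: w ++ [e], by simp, two_ne_zero', two_ne_one'⟩,
    ⟨[2, s], [e, 1] ++ [0], by simp⟩⟩
  refine AscFree.append (.append (.append (.of_length_lt (by simp)) hw ?_)
    (.of_length_lt (by simp)) ?_) (.of_length_lt (by simp)) ?_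
  · simp [hs]
  · simp [he, List.getLast?_cons]
  · simpa [List.getLast?_cons] using zero_ne_one_add_one

variable (N)

/-- An enumeration of all blocks. -/
noncomputable def block (k : ℕ) : List (Fin (N + 3)) :=
  (Classical.choose (@exists_surjective_nat {w : List (Fin (N + 3)) // Block w}
    block_nonempty _) k).1

lemma block_spec (k : ℕ) : Block (block N k) :=
  (Classical.choose (@exists_surjective_nat {w : List (Fin (N + 3)) // Block w}
    block_nonempty _) k).2

variable {N} in
lemma Block.exists_eq {w : List (Fin (N + 3))} (hw : Block w) : ∃ k, block N k = w := by
  obtain ⟨k, hk⟩ := Classical.choose_spec (@exists_surjective_nat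
    {w : List (Fin (N + 3)) // Block w} block_nonempty _) ⟨w, hw⟩
  exact ⟨k, congrArg Subtype.val hk⟩

/-- The concatenation of the letter `0` and the first `k` blocks. -/
noncomputable def longWord : ℕ → List (Fin (N + 3))
  | 0 => [0]
  | k + 1 => longWord k ++ block N k

lemma longWord_getLast? (k : ℕ) : (longWord N k).getLast? = some 0 := by
  cases k with
  | zero => rfl
  | succ k =>
    obtain ⟨-, x, u, h, -⟩ := block_spec N k
    simp [longWord, h, List.getLast?_append, List.getLast?_cons]

lemma longWord_ascFree (k : ℕ) : AscFree (longWord N k) := by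
  induction k with
  | zero => exact .of_length_lt (by simp [longWord])
  | succ k ih =>
    refine ih.append (block_spec N k).1 ?_
    obtain ⟨-, x, u, h, -, hx⟩ := block_spec N k
    simpa [longWord_getLast?, h] using hx

lemma longWord_prefix {i j : ℕ} (h : i ≤ j) : longWord N i <+: longWord N j := by
  induction j, h using Nat.le_induction with
  | base => exact List.prefix_rfl
  | succ j _ ih => exact ih.trans (List.prefix_append _ _)

/-- The length of `longWord N k`. -/
noncomputable def len (k : ℕ) : ℕ := (longWord N k).length

lemma len_zero : len N 0 = 1 := rfl

lemma len_add_three_le (k : ℕ) : len N k + 3 ≤ len N (k + 1) := by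
  obtain ⟨-, x, u, h, -⟩ := block_spec N k
  simp [len, longWord, h]

lemma len_strictMono : StrictMono (len N) :=
  strictMono_nat_of_lt_succ fun k => by have := len_add_three_le N k; omega

lemma lt_len (k : ℕ) : k < len N k := by
  induction k with
  | zero => simp [len_zero]
  | succ k ih => have := len_add_three_le N k; omega

/-- The letters of the infinite word all of whose prefixes are prefixes of some `longWord N k`. -/
noncomputable def letter (m : ℕ) : Fin (N + 3) := (longWord N m)[m]'(lt_len N m)

lemma getElem_longWord (k i : ℕ) (h : i < (longWord N k).length) :
    (longWord N k)[i] = letter N i := by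
  rcases le_total k i with hki | hki
  · exact (longWord_prefix N hki).getElem h
  · exact ((longWord_prefix N hki).getElem (lt_len N i)).symm

/-- The prefix of length `m` of the infinite word. -/
noncomputable def pre (m : ℕ) : List (Fin (N + 3)) := (List.range m).map (letter N)

lemma pre_succ (m : ℕ) : pre N (m + 1) = pre N m ++ [letter N m] := by
  simp [pre, List.range_succ]

lemma pre_length (m : ℕ) : (pre N m).length = m := by simp [pre]

lemma pre_len (k : ℕ) : pre N (len N k) = longWord N k :=
  List.ext_getElem (by simp [pre, len]) fun i _ h => by simp [pre, getElem_longWord N k i h]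

lemma pre_prefix {i j : ℕ} (h : i ≤ j) : pre N i <+: pre N j := by
  induction j, h using Nat.le_induction with
  | base => exact List.prefix_rfl
  | succ j _ ih => exact ih.trans (pre_succ N j ▸ List.prefix_append _ _)

lemma pre_ascFree (m : ℕ) : AscFree (pre N m) :=
  (pre_len N m ▸ longWord_ascFree N m).of_infix (pre_prefix N (lt_len N m).le).isInfix

lemma letter_len (k : ℕ) : letter N (len N k) ≠ 0 := by
  obtain ⟨-, x, u, h, hx, -⟩ := block_spec N k
  rw [← getElem_longWord N (k + 1) _ (len_strictMono N k.lt_succ_self)]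
  simpa [longWord, len, h] using hx

lemma letter_len_sub_one {k m : ℕ} (h : m + 1 = len N k) : letter N m = 0 := by
  have h1 := longWord_getLast? N k
  rw [← pre_len, ← h, pre_succ] at h1
  simpa [List.getLast?_append] using h1

lemma letter_len_sub_two {k m : ℕ} (h : m + 2 = len N (k + 1)) : letter N m = 1 := by
  have h1 := pre_len N (k + 1)
  rw [← h, pre_succ, pre_succ] at h1
  obtain ⟨-, x, u, h2, -⟩ := block_spec N k
  have h3 : pre N m ++ [letter N m, letter N (m + 1)] = (longWord N k ++ x :: u) ++ [1, 0] := by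
    simpa [longWord, h2] using h1
  have h4 : letter N m = 1 ∧ letter N (m + 1) = 0 := by
    simpa using (List.append_inj' h3 rfl).2
  exact h4.1

end Words

section Dynamics

variable (N : ℕ)

open Classical in
/-- The partial map on vertices given by the letter `x`: the vertex `p + 1` descends to `p` along
`letter N p`, and the letter `0` takes `len N k - 1` up to `len N (k + 1)`. -/
noncomputable def step (x : Fin (N + 3)) (m : ℕ) : Option ℕ :=
  if ∃ p, m = p + 1 ∧ letter N p = x then some (m - 1)
  else if h : x = 0 ∧ ∃ k, m + 1 = len N k then some (len N (h.2.choose + 1))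
  else none

lemma step_down (p : ℕ) : step N (letter N p) (p + 1) = some p := by
  simp [step]

lemma step_up {m k : ℕ} (h : m + 1 = len N k) : step N 0 m = some (len N (k + 1)) := by
  have h1 : ¬ ∃ p, m = p + 1 ∧ letter N p = 0 := by
    rintro ⟨p, rfl, hp⟩
    cases k with
    | zero => simp [len_zero] at h
    | succ k =>
      rw [letter_len_sub_two N h] at hp
      simp at hp
  have h2 : ∃ k, m + 1 = len N k := ⟨k, h⟩
  have h3 : h2.choose = k := (len_strictMono N).injective (h2.choose_spec.symm.trans h)
  rw [step, if_neg h1, dif_pos ⟨rfl, h2⟩, h3]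

lemma step_eq_some {x : Fin (N + 3)} {m j : ℕ} (h : step N x m = some j) :
    (m = j + 1 ∧ letter N j = x) ∨ (x = 0 ∧ ∃ k, m + 1 = len N k ∧ j = len N (k + 1)) := by
  unfold step at h
  split_ifs at h with h1 h2
  · obtain ⟨p, rfl, hp⟩ := h1
    left
    simp_all
  · obtain ⟨rfl, hk⟩ := h2
    exact .inr ⟨rfl, _, hk.choose_spec, (Option.some.inj h).symm⟩

/-- The partial map on vertices given by a word, its last letter acting first. -/
noncomputable def act : List (Fin (N + 3)) → ℕ → Option ℕ
  | [], m => some m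
  | x :: w, m => (act w m).bind (step N x)

lemma act_append (v w : List (Fin (N + 3))) (m : ℕ) :
    act N (v ++ w) m = (act N w m).bind (act N v) := by
  induction v with
  | nil => simp [act]
  | cons x v ih => simp [act, ih, Option.bind_assoc]

lemma act_pre_append {w : List (Fin (N + 3))} {j m : ℕ} (h : pre N m = pre N j ++ w) :
    act N w m = some j := by
  induction w generalizing j with
  | nil =>
    obtain rfl : m = j := by simpa [pre_length] using congrArg List.length h
    rfl
  | cons x w ih =>
    have hj : j < m := by
      have := congrArg List.length h
      simp [pre_length] at this
      omega
    have hp := pre_prefix N (Nat.succ_le_of_lt hj)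
    rw [h, Nat.succ_eq_add_one, pre_succ, List.prefix_append_right_inj] at hp
    have hx : letter N j = x := by simpa using hp
    rw [act, ih (j := j + 1) (by rw [h, pre_succ, hx]; simp), Option.bind_some, ← hx, step_down]

lemma act_pre {j m : ℕ} (h : j ≤ m) : ∃ w, act N w m = some j := by
  obtain ⟨w, hw⟩ := pre_prefix N h
  exact ⟨w, act_pre_append N hw.symm⟩

lemma le_of_act {w : List (Fin (N + 3))} {j m : ℕ} (h : act N w m = some j) :
    m ≤ j + w.length ∧ (m = j + w.length → pre N m = pre N j ++ w) := by
  induction w generalizing j with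
  | nil => simp_all [act]
  | cons x w ih =>
    rw [act, Option.bind_eq_some_iff] at h
    obtain ⟨p, hp, hj⟩ := h
    obtain ⟨h1, h2⟩ := ih hp
    rw [List.length_cons]
    rcases step_eq_some N hj with ⟨rfl, rfl⟩ | ⟨-, k, hk, rfl⟩
    · refine ⟨by omega, fun h => ?_⟩
      rw [h2 (by omega), pre_succ, List.append_assoc, List.singleton_append]
    · have := len_strictMono N k.lt_add_one
      exact ⟨by omega, fun h => by omega⟩

lemma step_step {x y : Fin (N + 3)} (hxy : x ≠ y) {m p j : ℕ} (hy : step N y m = some p)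
    (hx : step N x p = some j) : m = p + 1 ∧ p = j + 1 := by
  rcases step_eq_some N hy with ⟨hm, rfl⟩ | ⟨rfl, k, -, rfl⟩ <;>
  rcases step_eq_some N hx with ⟨hp, rfl⟩ | ⟨rfl, l, hl, -⟩
  · exact ⟨hm, hp⟩
  · exact absurd (letter_len_sub_one N hl).symm hxy
  · exact absurd (letter_len_sub_one N hp.symm) hxy
  · exact absurd rfl hxy

lemma act_isChain_ne {x y : Fin (N + 3)} {w : List (Fin (N + 3))}
    (hw : (x :: y :: w).IsChain (· ≠ ·)) {m j : ℕ} (h : act N (x :: y :: w) m = some j) :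
    m = j + (w.length + 2) := by
  induction w generalizing x y j with
  | nil =>
    obtain ⟨p, hp, hj⟩ := Option.bind_eq_some_iff.1 h
    have := step_step N (List.isChain_cons_cons.1 hw).1 (by simpa [act] using hp) hj
    simp; omega
  | cons z w ih =>
    obtain ⟨p, hp, hj⟩ := Option.bind_eq_some_iff.1 h
    have h1 := ih (List.isChain_cons_cons.1 hw).2 hp
    obtain ⟨q, -, hq⟩ := Option.bind_eq_some_iff.1 hp
    have := step_step N (List.isChain_cons_cons.1 hw).1 hq hj
    simp; omega

lemma act_asc {w : List (Fin (N + 3))} (hw : Asc w) (hl : w.length = N + 3) (m : ℕ) :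
    act N w m = none := by
  by_contra! h
  obtain ⟨j, hj⟩ := Option.ne_none_iff_exists'.1 h
  match w, hl with
  | x :: y :: w, hl =>
    have h1 := act_isChain_ne N
      (hw.imp fun a b (hab : b = a + 1) => hab ▸ ne_add_one a) hj
    have h2 := (le_of_act N hj).2 (by simpa using h1)
    have := pre_ascFree N m (x :: y :: w) (h2 ▸ (List.suffix_append _ _).isInfix) hw
    omega

lemma exists_act_unique {w : List (Fin (N + 3))} (hw : AscFree w) :
    ∃ m j, act N w m = some j ∧ ∀ v, v.length ≤ w.length → act N v m = some j → v = w := by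
  obtain ⟨m, j, h⟩ : ∃ m j, pre N m = pre N j ++ w := by
    rcases eq_or_ne w [] with rfl | hne
    · exact ⟨0, 0, by simp⟩
    · obtain ⟨b, hb, s, t, rfl⟩ := hw.exists_block hne
      obtain ⟨k, hk⟩ := hb.exists_eq
      have h1 : pre N (len N (k + 1)) = (longWord N k ++ s) ++ w ++ t := by
        simp [pre_len, longWord, hk]
      have h2 : ∀ {u v : List (Fin (N + 3))}, pre N (len N (k + 1)) = u ++ v →
          pre N u.length = u := by
        intro u v huv
        have hp := pre_prefix N (i := u.length) (j := len N (k + 1))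
          (by have := congrArg List.length huv; simp [pre_length] at this; omega)
        rw [huv] at hp
        exact (List.prefix_of_prefix_length_le hp (List.prefix_append u v)
          (by simp [pre_length])).eq_of_length (by simp [pre_length])
      refine ⟨((longWord N k ++ s) ++ w).length, (longWord N k ++ s).length, ?_⟩
      rw [h2 h1, h2 (h1.trans (List.append_assoc _ _ _))]
  refine ⟨m, j, act_pre_append N h, fun v hv hj => ?_⟩
  have h1 := congrArg List.length h
  rw [List.length_append, pre_length, pre_length] at h1
  obtain ⟨h2, h3⟩ := le_of_act N hj
  exact (List.append_cancel_left (h.symm.trans (h3 (by omega)))).symm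

lemma step_injective {x : Fin (N + 3)} {m m' j : ℕ} (h : step N x m = some j)
    (h' : step N x m' = some j) : m = m' := by
  rcases step_eq_some N h with ⟨hm, hx⟩ | ⟨rfl, k, hk, rfl⟩ <;>
  rcases step_eq_some N h' with ⟨hm', hx'⟩ | ⟨hx', k', hk', hj'⟩
  · omega
  · subst hj'
    exact absurd (hx.trans hx') (letter_len N _)
  · exact absurd hx' (letter_len N _)
  · have := (len_strictMono N).injective hj'
    have : k = k' := by omega
    subst this; omega

lemma act_injective {w : List (Fin (N + 3))} {m m' j : ℕ} (h : act N w m = some j)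
    (h' : act N w m' = some j) : m = m' := by
  induction w generalizing j with
  | nil => simp_all [act]
  | cons x w ih =>
    obtain ⟨p, hp, hj⟩ := Option.bind_eq_some_iff.1 h
    obtain ⟨p', hp', hj'⟩ := Option.bind_eq_some_iff.1 h'
    exact ih hp (step_injective N hj hj' ▸ hp')

lemma exists_act_eq (m m' : ℕ) : ∃ w, act N w m = some m' := by
  have h1 : ∀ k, ∃ w, act N w 0 = some (len N (k + 1)) := by
    intro k
    induction k with
    | zero => exact ⟨[0], by simp [act, step_up N (len_zero N).symm]⟩
    | succ k ih =>
      obtain ⟨w, hw⟩ := ih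
      obtain ⟨p, hp⟩ : ∃ p, len N (k + 1) = p + 1 :=
        ⟨_, (Nat.succ_pred_eq_of_pos (by have := lt_len N (k + 1); omega)).symm⟩
      refine ⟨0 :: letter N p :: w, ?_⟩
      simp [act, hw, hp, step_down, step_up N hp.symm]
  obtain ⟨u, hu⟩ := act_pre N m.zero_le
  obtain ⟨v, hv⟩ := h1 m'
  obtain ⟨w, hw⟩ := act_pre N (show m' ≤ len N (m' + 1) by have := lt_len N (m' + 1); omega)
  exact ⟨w ++ (v ++ u), by simp [act_append, hu, hv, hw]⟩

/-- The vertices on the orbit of `1` under the letter `0`. -/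
def OnOrbit (m : ℕ) : Prop := ∃ k, m = len N k ∨ m + 1 = len N k

lemma step_onOrbit {m : ℕ} (h : OnOrbit N m) : ∃ j, step N 0 m = some j ∧ OnOrbit N j := by
  obtain ⟨k, rfl | h⟩ := h
  · obtain ⟨p, hp⟩ : ∃ p, len N k = p + 1 :=
      ⟨_, (Nat.succ_pred_eq_of_pos (by have := lt_len N k; omega)).symm⟩
    refine ⟨p, ?_, k, .inr hp.symm⟩
    rw [hp, ← letter_len_sub_one N hp.symm, step_down]
  · exact ⟨_, step_up N h, _, .inl rfl⟩

lemma act_zeros_onOrbit {m : ℕ} (h : OnOrbit N m) (r : ℕ) :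
    ∃ j, act N (List.replicate r 0) m = some j ∧ OnOrbit N j := by
  induction r with
  | zero => exact ⟨m, rfl, h⟩
  | succ r ih =>
    obtain ⟨j, hj, hj'⟩ := ih
    simpa [List.replicate_succ, act, hj] using step_onOrbit N hj'

lemma onOrbit_or_act_zeros (m : ℕ) :
    OnOrbit N m ∨ ∃ r, act N (List.replicate r 0) m = none := by
  induction m with
  | zero => exact .inl ⟨0, .inr (len_zero N).symm⟩
  | succ p ih =>
    rcases h : step N 0 (p + 1) with _ | j
    · exact .inr ⟨1, by simpa [act] using h⟩
    rcases step_eq_some N h with ⟨hp, hj⟩ | ⟨-, k, hk, -⟩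
    · obtain rfl : p = j := by omega
      rcases ih with ⟨k, rfl | hk⟩ | ⟨r, hr⟩
      · exact absurd hj (letter_len N k)
      · exact .inl ⟨k, .inl hk⟩
      · refine .inr ⟨r + 1, ?_⟩
        rw [List.replicate_succ', act_append]
        simpa [act, h] using hr
    · exact .inl ⟨k, .inr hk⟩

/-- The word `w` acts on exactly one of the vertices `m` and `m'`. -/
def Separates (w : List (Fin (N + 3))) (m m' : ℕ) : Prop :=
  (act N w m).isSome ≠ (act N w m').isSome

lemma exists_separates_zero {q : ℕ} (hq : q ≠ 0) : ∃ w, Separates N w 0 q := by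
  have h0 : OnOrbit N 0 := ⟨0, .inr (len_zero N).symm⟩
  have h01 : step N 0 0 = some (len N 1) := step_up N (len_zero N).symm
  have h10 : step N 1 0 = none := by
    by_contra! h
    obtain ⟨j, hj⟩ := Option.ne_none_iff_exists'.1 h
    rcases step_eq_some N hj with ⟨h, -⟩ | ⟨h, -⟩ <;> simp at h
  have hlen : ∀ k, step N 1 (len N k) = none := by
    intro k
    by_contra! h
    obtain ⟨j, hj⟩ := Option.ne_none_iff_exists'.1 h
    rcases step_eq_some N hj with ⟨h, h'⟩ | ⟨h, -⟩
    · rw [letter_len_sub_one N h.symm] at h'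
      simp at h'
    · simp at h
  have hsub : ∀ {k p}, p + 2 = len N (k + 1) → step N 1 (p + 1) = some p := by
    intro k p h
    rw [← letter_len_sub_two N h, step_down]
  have hpos : ∀ k, ∃ p, p + 2 = len N (k + 1) := fun k =>
    ⟨len N (k + 1) - 2, by have := len_add_three_le N k; omega⟩
  have hlen0 : ∀ {k p}, p + 1 = len N k → step N 0 (len N k) = some p := by
    intro k p h
    rw [← h, ← letter_len_sub_one N h, step_down]
  rcases onOrbit_or_act_zeros N q with ⟨k, rfl | hk⟩ | ⟨r, hr⟩
  · cases k with
    | zero =>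
      obtain ⟨p, hp⟩ := hpos 0
      refine ⟨[1, 0, 0], ?_⟩
      simp [Separates, act, h01, hlen0 (p := 0) (len_zero N).symm, hlen0 hp, hsub hp, hlen]
    | succ k =>
      obtain ⟨p, hp⟩ := hpos k
      refine ⟨[1, 0], ?_⟩
      simp [Separates, act, h01, hlen, hlen0 hp, hsub hp]
  · cases k with
    | zero => rw [len_zero] at hk; omega
    | succ k =>
      obtain ⟨p, hp⟩ := hpos k
      obtain rfl : q = p + 1 := by omega
      exact ⟨[1], by simp [Separates, act, h10, hsub hp]⟩
  · obtain ⟨j, hj, -⟩ := act_zeros_onOrbit N h0 r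
    exact ⟨List.replicate r 0, by simp [Separates, hr, hj]⟩

lemma exists_separates {m m' : ℕ} (h : m ≠ m') : ∃ w, Separates N w m m' := by
  obtain ⟨u, hu⟩ := act_pre N m.zero_le
  rcases hq : act N u m' with _ | q
  · exact ⟨u, by simp [Separates, hu, hq]⟩
  · have hq0 : q ≠ 0 := by
      rintro rfl
      exact h (act_injective N hu hq)
    obtain ⟨w, hw⟩ := exists_separates_zero N hq0
    exact ⟨w ++ u, by simpa [Separates, act_append, hu, hq] using hw⟩

end Dynamics

section Representation

variable (N : ℕ) (K : Type*) [Field K]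

/-- The linear operator induced by the partial map `step N x`. -/
noncomputable def stepOp (x : Fin (N + 3)) : Module.End K (ℕ →₀ K) :=
  Finsupp.linearCombination K fun m => (step N x m).elim 0 fun j => Finsupp.single j 1

lemma prod_stepOp_single (w : List (Fin (N + 3))) (m : ℕ) :
    (w.map (stepOp N K)).prod (Finsupp.single m 1) =
      (act N w m).elim 0 fun j => Finsupp.single j 1 := by
  induction w with
  | nil => simp [act]
  | cons x w ih =>
    rw [List.map_cons, List.prod_cons, Module.End.mul_apply, ih, act]
    cases act N w m <;> simp [stepOp]

variable {K}

lemma prod_stepOp_apply {w : List (Fin (N + 3))} {m j : ℕ} (h : act N w m = some j)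
    (v : ℕ →₀ K) : (w.map (stepOp N K)).prod v j = v m := by
  induction v using Finsupp.induction_linear with
  | zero => simp
  | add f g hf hg => simp [hf, hg]
  | single a b =>
    rw [← mul_one b, ← smul_eq_mul, ← Finsupp.smul_single, map_smul, prod_stepOp_single]
    rcases eq_or_ne a m with rfl | hne
    · simp [h]
    · rcases ha : act N w a with _ | i
      · simp [hne]
      · have hij : i ≠ j := by
          rintro rfl
          exact hne (act_injective N ha h)
        simp [hij, hne]

lemma prod_stepOp_apply_eq_zero {w : List (Fin (N + 3))} {j : ℕ}
    (h : ∀ m, act N w m ≠ some j) (v : ℕ →₀ K) : (w.map (stepOp N K)).prod v j = 0 := by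
  induction v using Finsupp.induction_linear with
  | zero => simp
  | add f g hf hg => simp [hf, hg]
  | single a b =>
    rw [← mul_one b, ← smul_eq_mul, ← Finsupp.smul_single, map_smul, prod_stepOp_single]
    rcases ha : act N w a with _ | i
    · simp
    · have hij : i ≠ j := by
        rintro rfl
        exact h a ha
      simp [hij]

lemma card_support_prod_stepOp_lt {w : List (Fin (N + 3))} {v : ℕ →₀ K} {m : ℕ}
    (hm : m ∈ v.support) (h : act N w m = none) :
    ((w.map (stepOp N K)).prod v).support.card < v.support.card := by
  refine lt_of_le_of_lt (Finset.card_le_card (t := (v.support.erase m).image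
    fun i => (act N w i).getD 0) fun j hj => ?_)
    (Finset.card_image_le.trans_lt (Finset.card_erase_lt_of_mem hm))
  rw [Finsupp.mem_support_iff] at hj
  by_cases hex : ∃ i, act N w i = some j
  · obtain ⟨i, hi⟩ := hex
    rw [prod_stepOp_apply N hi] at hj
    refine Finset.mem_image.2 ⟨i, Finset.mem_erase.2
      ⟨?_, Finsupp.mem_support_iff.2 hj⟩, by simp [hi]⟩
    rintro rfl
    simp [h] at hi
  · exact absurd (prod_stepOp_apply_eq_zero N (not_exists.1 hex) v) hj

lemma eq_bot_or_eq_top_of_stepOp_mem (p : Submodule K (ℕ →₀ K))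
    (hp : ∀ x, ∀ v ∈ p, stepOp N K x v ∈ p) : p = ⊥ ∨ p = ⊤ := by
  have hw : ∀ w : List (Fin (N + 3)), ∀ v ∈ p, (w.map (stepOp N K)).prod v ∈ p := by
    intro w v hv
    induction w with
    | nil => simpa using hv
    | cons x w ih => simpa using hp x _ ih
  have hsingle : ∀ d, ∀ v ∈ p, v ≠ 0 → v.support.card = d →
      ∃ m, Finsupp.single m (1 : K) ∈ p := by
    intro d
    induction d using Nat.strong_induction_on with
    | _ d ih =>
      rintro v hv hv0 rfl
      obtain ⟨m, hm⟩ := Finsupp.support_nonempty_iff.2 hv0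
      by_cases hex : ∃ m' ∈ v.support, m ≠ m'
      · obtain ⟨m', hm', hne⟩ := hex
        obtain ⟨w, hs⟩ := exists_separates N hne
        have key : ∀ a ∈ v.support, ∀ b ∈ v.support, act N w a = none →
            (act N w b).isSome → ∃ m, Finsupp.single m (1 : K) ∈ p := by
          intro a ha b hb hna hsb
          obtain ⟨j, hj⟩ := Option.isSome_iff_exists.1 hsb
          refine ih _ (card_support_prod_stepOp_lt N ha hna) _ (hw w v hv) (fun h0 => ?_) rfl
          have := prod_stepOp_apply N hj v
          rw [h0] at this
          exact Finsupp.mem_support_iff.1 hb this.symm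
        rcases h1 : act N w m with _ | i <;> rcases h2 : act N w m' with _ | i'
        · simp [Separates, h1, h2] at hs
        · exact key m hm m' hm' h1 (by simp [h2])
        · exact key m' hm' m hm h2 (by simp [h1])
        · simp [Separates, h1, h2] at hs
      · push Not at hex
        have hv1 : v = Finsupp.single m (v m) := by
          ext a
          by_cases ha : a ∈ v.support
          · rw [← hex a ha]; simp
          · rw [Finsupp.notMem_support_iff.1 ha, Finsupp.single_apply, if_neg]
            rintro rfl
            exact ha hm
        refine ⟨m, ?_⟩
        have := p.smul_mem (v m)⁻¹ hv
        rw [hv1] at this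
        simpa [Finsupp.mem_support_iff.1 hm] using this
  refine or_iff_not_imp_left.2 fun hbot => ?_
  obtain ⟨v, hv, hv0⟩ := Submodule.exists_mem_ne_zero_of_ne_bot hbot
  obtain ⟨m, hm⟩ := hsingle _ v hv hv0 rfl
  rw [Submodule.eq_top_iff']
  intro u
  induction u using Finsupp.induction_linear with
  | zero => exact p.zero_mem
  | add f g hf hg => exact p.add_mem hf hg
  | single a b =>
    obtain ⟨w, hwa⟩ := exists_act_eq N m a
    have := hw w _ hm
    rw [prod_stepOp_single, hwa] at this
    simpa using p.smul_mem b this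

lemma exists_simple_faithful.{u, v} (K : Type u) [Field K] {R : Type v} [Ring R]
    (f : R →+* Module.End K (ℕ →₀ K)) (hf : Function.Injective f)
    (hK : ∀ r, ∃ y, f y = algebraMap K _ r) (hx : ∀ x, ∃ y, f y = stepOp N K x) :
    ∃ (V : Type u) (_ : AddCommGroup V) (_ : Module R V),
      IsSimpleModule R V ∧ FaithfulSMul R V := by
  refine ⟨ℕ →₀ K, inferInstance, Module.compHom (ℕ →₀ K) f, ?_⟩
  let _ : Module R (ℕ →₀ K) := Module.compHom (ℕ →₀ K) f
  have hsmul : ∀ (y : R) (v : ℕ →₀ K), y • v = f y v := fun _ _ => rfl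
  refine ⟨(isSimpleModule_iff _ _).2 ⟨fun q => ?_⟩, ⟨fun {y z} h => hf (LinearMap.ext h)⟩⟩
  let p : Submodule K (ℕ →₀ K) :=
    { q.toAddSubmonoid with
      smul_mem' := fun r v hv => by
        obtain ⟨y, hy⟩ := hK r
        have := q.smul_mem y hv
        rwa [hsmul, hy, Module.algebraMap_end_apply] at this }
  have hpq : ∀ v, v ∈ p ↔ v ∈ q := fun _ => Iff.rfl
  refine (eq_bot_or_eq_top_of_stepOp_mem N p fun x v hv => ?_).imp (fun h => ?_) fun h => ?_
  · obtain ⟨y, hy⟩ := hx x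
    rw [← hy, ← hsmul]
    exact q.smul_mem y hv
  · ext v; rw [← hpq, h]; simp
  · ext v; rw [← hpq, h]; simp

end Representation

section Presentation

variable {N : ℕ}

/-- The presentation map of `Scyc n`. -/
def presentation (n : ℕ) : FreeMonoid (Fin n) →* Scyc n := (conGen (cycRel n)).mk'

lemma presentation_apply {n : ℕ} (w : FreeMonoid (Fin n)) :
    presentation n w = (w.toList.map agen).prod := by
  have : presentation n = FreeMonoid.lift agen := FreeMonoid.hom_eq fun x => by
    rw [FreeMonoid.lift_eval_of]; rfl
  rw [this, FreeMonoid.lift_apply]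

lemma exists_prod_agen {n : ℕ} (s : Scyc n) : ∃ w : List (Fin n), (w.map agen).prod = s := by
  obtain ⟨w, hw⟩ := Con.mk'_surjective (c := conGen (cycRel n)) s
  exact ⟨w.toList, (presentation_apply w).symm.trans hw⟩

lemma toList_permWord {n : ℕ} (σ : Equiv.Perm (Fin n)) :
    (permWord n σ).toList = (List.finRange n).map σ := by
  have h : ∀ l : List (Fin n), (l.map fun i => FreeMonoid.of (σ i)).prod.toList = l.map σ := by
    intro l
    induction l with
    | nil => rfl
    | cons x l ih =>
      rw [List.map_cons, List.prod_cons, FreeMonoid.toList_mul, ih, FreeMonoid.toList_of]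
      rfl
  exact h _

lemma ofNat_succ (i : ℕ) : Fin.ofNat (N + 3) (i + 1) = Fin.ofNat (N + 3) i + 1 := by
  simp [Fin.ext_iff, Fin.val_add]

lemma finRotate_pow_apply (k : ℕ) (i : Fin (N + 3)) :
    (finRotate (N + 3) ^ k) i = i + Fin.ofNat (N + 3) k := by
  induction k with
  | zero => simp
  | succ k ih => rw [pow_succ', Equiv.Perm.mul_apply, ih, finRotate_apply, ofNat_succ, add_assoc]

lemma asc_toList_permWord (k : ℕ) : Asc (permWord (N + 3) (finRotate (N + 3) ^ k)).toList := by
  refine (toList_permWord _).symm ▸ List.isChain_iff_getElem.2 ?_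
  intro i hi
  simp only [List.getElem_map, List.getElem_finRange, finRotate_pow_apply]
  rw [add_right_comm]
  congr 1
  simp at hi
  simp [Fin.ext_iff, Fin.val_add, Nat.mod_eq_of_lt (show i + 1 < N + 3 by omega)]

lemma Asc.getElem {w : List (Fin (N + 3))} (hw : Asc w) {i : ℕ} (hi : i < w.length) :
    w[i] = Fin.ofNat (N + 3) i + w[0] := by
  induction i with
  | zero => simp
  | succ i ih => rw [List.isChain_iff_getElem.1 hw i hi, ih, ofNat_succ, add_right_comm]

lemma Asc.prod_agen {w : List (Fin (N + 3))} (hw : Asc w) (hl : w.length = N + 3) :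
    (w.map agen).prod = zc (N + 3) := by
  have hz : presentation (N + 3) (permWord (N + 3) 1) = zc (N + 3) := by
    rw [presentation_apply, toList_permWord]
    simp [zc]
  have hw' : w = (permWord (N + 3) (finRotate (N + 3) ^ (w[0]).val)).toList := by
    rw [toList_permWord]
    refine List.ext_getElem (by simp [hl]) fun i h1 h2 => ?_
    rw [Asc.getElem hw, List.getElem_map, List.getElem_finRange, finRotate_pow_apply,
      Fin.ofNat_val_eq_self]
    congr 1
    simp [Fin.ext_iff, Nat.mod_eq_of_lt (hl ▸ h1)]
  rw [← hz, hw', ← presentation_apply]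
  exact ((Con.eq _).2 (ConGen.Rel.of _ _ ⟨rfl, _, rfl⟩)).symm

lemma agen_mul_zc (x : Fin (N + 3)) :
    (agen x : Scyc (N + 3)) * zc (N + 3) = zc (N + 3) * agen x := by
  have asc : ∀ y : Fin (N + 3), Asc ((List.range (N + 3)).map fun i => y + Fin.ofNat (N + 3) i) := by
    intro y
    refine List.isChain_iff_getElem.2 fun i hi => ?_
    simp only [List.getElem_map, List.getElem_range, ofNat_succ, add_assoc]
  have hz := fun y => Asc.prod_agen (asc y) (by simp)
  have h1 : (agen x : Scyc (N + 3)) = agen (x + Fin.ofNat (N + 3) 0) := by simp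
  have h2 : (agen x : Scyc (N + 3)) = agen (x + Fin.ofNat (N + 3) (N + 3)) := by
    simp [Fin.ofNat_self]
  have h3 := congrArg (fun l => ((l.map fun i : ℕ => x + Fin.ofNat (N + 3) i).map agen).prod)
    ((List.range_succ_eq_map (n := N + 3)).symm.trans List.range_succ)
  simp only [List.map_cons, List.map_append, List.prod_cons, List.prod_append, List.map_nil,
    List.prod_nil, mul_one, List.map_map, ← h1, ← h2] at h3
  have h4 : (fun i => x + Fin.ofNat (N + 3) i) ∘ Nat.succ =
      fun i => x + 1 + Fin.ofNat (N + 3) i := by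
    funext i
    rw [Function.comp_apply, Nat.succ_eq_add_one, ofNat_succ, add_assoc, add_comm 1]
  rwa [h4, ← List.map_map, ← List.map_map, hz, hz] at h3

lemma mul_zc (s : Scyc (N + 3)) : s * zc (N + 3) = zc (N + 3) * s := by
  obtain ⟨w, rfl⟩ := exists_prod_agen s
  induction w with
  | nil => simp
  | cons x w ih =>
    rw [List.map_cons, List.prod_cons, mul_assoc, ih, ← mul_assoc, agen_mul_zc, mul_assoc]

lemma exists_eq_zc_mul {w : List (Fin (N + 3))} (hw : ¬ AscFree w) :
    ∃ s, (w.map agen).prod = zc (N + 3) * s := by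
  unfold AscFree at hw
  push Not at hw
  obtain ⟨r, ⟨u, v, rfl⟩, hr, hl⟩ := hw
  have h := Asc.prod_agen (hr.infix (List.take_prefix (N + 3) r).isInfix) (by simpa using hl)
  rw [← List.take_append_drop (N + 3) r]
  simp only [List.map_append, List.prod_append, h]
  exact ⟨(u.map agen).prod * ((r.drop (N + 3)).map agen).prod * (v.map agen).prod, by
    simp only [← mul_assoc, mul_zc]⟩

end Presentation

section Quotient

variable {N : ℕ} {K E : Type*} [Field K] [Ring E] [Algebra K E]

/-- The images of the generators of `Scyc (N + 3)` in an algebra extend to a monoid homomorphism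
as soon as the rotations of `a_1 ⋯ a_n` are sent to zero. -/
def liftHom (B : Fin (N + 3) → E)
    (hB : ∀ w, Asc w → w.length = N + 3 → (w.map B).prod = 0) : Scyc (N + 3) →* E :=
  (conGen (cycRel (N + 3))).lift (FreeMonoid.lift B) <| Con.conGen_le.2 <| by
    rintro _ _ ⟨rfl, k, rfl⟩
    have h : ∀ k : ℕ,
        FreeMonoid.lift B (permWord (N + 3) (finRotate (N + 3) ^ k)) = 0 := fun k => by
      rw [FreeMonoid.lift_apply]
      exact hB _ (asc_toList_permWord k) (by simp [toList_permWord])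
    exact (h 0).trans (h k).symm

lemma liftHom_prod_agen (B : Fin (N + 3) → E)
    (hB : ∀ w, Asc w → w.length = N + 3 → (w.map B).prod = 0) (w : List (Fin (N + 3))) :
    liftHom B hB (w.map agen).prod = (w.map B).prod := by
  have h : ∀ x, liftHom B hB (agen x) = B x := fun x => FreeMonoid.lift_eval_of B x
  rw [map_list_prod, List.map_map]
  congr 2

lemma liftHom_zc_mul (B : Fin (N + 3) → E)
    (hB : ∀ w, Asc w → w.length = N + 3 → (w.map B).prod = 0) (s : Scyc (N + 3)) :
    liftHom B hB (zc (N + 3) * s) = 0 := by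
  have hasc := asc_toList_permWord (N := N) 0
  have hlen : (permWord (N + 3) (finRotate (N + 3) ^ 0)).toList.length = N + 3 := by
    simp [toList_permWord]
  rw [map_mul, ← Asc.prod_agen hasc hlen, liftHom_prod_agen, hB _ hasc hlen, zero_mul]

lemma mem_of_lift_liftHom_eq_zero (B : Fin (N + 3) → E)
    (hB : ∀ w, Asc w → w.length = N + 3 → (w.map B).prod = 0)
    (hl : ∀ w, AscFree w → ∃ l : E →ₗ[K] K, l (w.map B).prod ≠ 0 ∧
      ∀ v, v.length ≤ w.length → v ≠ w → l (v.map B).prod = 0)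
    {x : MonoidAlgebra K (Scyc (N + 3))}
    (hx : MonoidAlgebra.lift K E (Scyc (N + 3)) (liftHom B hB) x = 0) :
    x ∈ Submodule.span K
      (MonoidAlgebra.of K (Scyc (N + 3)) '' {x | ∃ s, x = zc (N + 3) * s}) := by
  classical
  choose rep hrep using exists_prod_agen (n := N + 3)
  have hF : ∀ s, liftHom B hB s = ((rep s).map B).prod := fun s => by
    conv_lhs => rw [← hrep s, liftHom_prod_agen]
  have hP : ∀ s, ¬ AscFree (rep s) → ∃ t, s = zc (N + 3) * t := fun s hs => by
    obtain ⟨t, ht⟩ := exists_eq_zc_mul hs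
    exact ⟨t, (hrep s).symm.trans ht⟩
  rcases (x.coeff.support.filter fun s => AscFree (rep s)).eq_empty_or_nonempty with h | h
  · rw [← MonoidAlgebra.sum_coeff_single x]
    refine Submodule.sum_mem _ fun s hs => ?_
    obtain ⟨t, ht⟩ := hP s fun hs' =>
      Finset.notMem_empty s (h ▸ Finset.mem_filter.2 ⟨hs, hs'⟩)
    have := Submodule.smul_mem _ (x.coeff s) (Submodule.subset_span (R := K)
      (Set.mem_image_of_mem (MonoidAlgebra.of K (Scyc (N + 3)))
        (show s ∈ {x | ∃ s, x = zc (N + 3) * s} from ⟨t, ht⟩)))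
    simpa [MonoidAlgebra.of_apply] using this
  · obtain ⟨s, hs, hmax⟩ := Finset.exists_max_image _ (fun s => (rep s).length) h
    rw [Finset.mem_filter] at hs
    obtain ⟨l, hl1, hl2⟩ := hl _ hs.2
    refine absurd (congrArg l hx) ?_
    rw [MonoidAlgebra.lift_apply, Finsupp.sum, map_sum, map_zero,
      Finset.sum_eq_single_of_mem s hs.1]
    · rw [map_smul, hF, smul_eq_mul]
      exact mul_ne_zero (Finsupp.mem_support_iff.1 hs.1) hl1
    · intro t ht hts
      rw [map_smul, smul_eq_mul]
      by_cases hfree : AscFree (rep t)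
      · rw [hF, hl2 _ (hmax t (Finset.mem_filter.2 ⟨ht, hfree⟩)), mul_zero]
        intro heq
        exact hts (by rw [← hrep t, ← hrep s, heq])
      · obtain ⟨u, rfl⟩ := hP t hfree
        rw [liftHom_zc_mul, map_zero, mul_zero]

lemma exists_quotient_ringHom (B : Fin (N + 3) → E)
    (hB : ∀ w, Asc w → w.length = N + 3 → (w.map B).prod = 0)
    (hl : ∀ w, AscFree w → ∃ l : E →ₗ[K] K, l (w.map B).prod ≠ 0 ∧
      ∀ v, v.length ≤ w.length → v ≠ w → l (v.map B).prod = 0)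
    {KP : Submodule K (MonoidAlgebra K (Scyc (N + 3)))}
    (hKP : KP = Submodule.span K
      (MonoidAlgebra.of K (Scyc (N + 3)) '' {x | ∃ s, x = zc (N + 3) * s}))
    {c : RingCon (MonoidAlgebra K (Scyc (N + 3)))}
    (hc : c = ringConGen (fun x y => x - y ∈ KP)) :
    ∃ f : c.Quotient →+* E, Function.Injective f ∧ (∀ r, ∃ y, f y = algebraMap K E r) ∧
      ∀ x, ∃ y, f y = B x := by
  let F := MonoidAlgebra.lift K E (Scyc (N + 3)) (liftHom B hB)
  have hker : KP ≤ LinearMap.ker F.toLinearMap := by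
    rw [hKP, Submodule.span_le]
    rintro _ ⟨_, ⟨s, rfl⟩, rfl⟩
    simpa [F, MonoidAlgebra.of_apply] using liftHom_zc_mul B hB s
  have hle : c ≤ RingCon.ker (F : MonoidAlgebra K (Scyc (N + 3)) →+* E) := by
    rw [hc, RingCon.ringConGen_le]
    intro x y hxy
    have := hker hxy
    rw [LinearMap.mem_ker, AlgHom.toLinearMap_apply, map_sub] at this
    exact sub_eq_zero.1 this
  refine ⟨c.lift _ hle, ?_, fun r => ⟨c.mk' (algebraMap K _ r), ?_⟩,
    fun x => ⟨c.mk' (MonoidAlgebra.of K _ (agen x)), ?_⟩⟩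
  · intro a b hab
    obtain ⟨x, rfl⟩ := c.mk'_surjective a
    obtain ⟨y, rfl⟩ := c.mk'_surjective b
    rw [RingCon.lift_mk', RingCon.lift_mk'] at hab
    refine (c.eq).2 ?_
    rw [hc]
    refine RingConGen.Rel.of _ _ ?_
    rw [hKP]
    refine mem_of_lift_liftHom_eq_zero B hB hl ?_
    rw [map_sub]
    exact sub_eq_zero.2 hab
  · exact (c.lift_mk' hle _).trans (F.commutes r)
  · refine (c.lift_mk' hle _).trans ?_
    have := liftHom_prod_agen B hB [x]
    simpa [F, MonoidAlgebra.of_apply] using this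

end Quotient

section Flip

variable {N : ℕ}

/-- The anti-automorphism of the free monoid that induces one of `Scyc (N + 3)`. -/
def revFlip (w : List (Fin (N + 3))) : List (Fin (N + 3)) := (w.map Fin.rev).reverse

lemma revFlip_revFlip (w : List (Fin (N + 3))) : revFlip (revFlip w) = w := by
  simp [revFlip, Function.comp_def]

lemma length_revFlip (w : List (Fin (N + 3))) : (revFlip w).length = w.length := by simp [revFlip]

lemma Asc.revFlip {w : List (Fin (N + 3))} (hw : Asc w) : Asc (revFlip w) := by
  refine List.isChain_reverse.2 ((List.isChain_map _).2 (hw.imp fun a b hab => ?_))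
  rw [hab, Fin.rev_add, sub_add_cancel]

lemma AscFree.revFlip {w : List (Fin (N + 3))} (hw : AscFree w) : AscFree (revFlip w) := by
  rintro r ⟨u, v, h⟩ hr
  rw [← length_revFlip]
  refine hw _ ⟨CyclicMonoid.revFlip v, CyclicMonoid.revFlip u, ?_⟩ hr.revFlip
  rw [← revFlip_revFlip w, ← h]
  simp [CyclicMonoid.revFlip]

end Flip

section Functional

variable (N : ℕ) (K : Type*) [Field K]

lemma prod_stepOp_asc (w : List (Fin (N + 3))) (hw : Asc w) (hl : w.length = N + 3) :
    (w.map (stepOp N K)).prod = 0 := by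
  refine Finsupp.lhom_ext' fun m => LinearMap.ext_ring ?_
  simp [prod_stepOp_single, act_asc N hw hl]

lemma exists_functional (w : List (Fin (N + 3))) (hw : AscFree w) :
    ∃ l : Module.End K (ℕ →₀ K) →ₗ[K] K, l (w.map (stepOp N K)).prod ≠ 0 ∧
      ∀ v, v.length ≤ w.length → v ≠ w → l (v.map (stepOp N K)).prod = 0 := by
  obtain ⟨m, j, h, huniq⟩ := exists_act_unique N hw
  refine ⟨Finsupp.lapply j ∘ₗ LinearMap.applyₗ (Finsupp.single m 1), ?_, fun v hv hne => ?_⟩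
  · simp [prod_stepOp_single, h]
  · have hv' : act N v m ≠ some j := fun h' => hne (huniq v hv h')
    rcases hi : act N v m with _ | i
    · simp [prod_stepOp_single, hi]
    · have hij : i ≠ j := fun hij => hv' (hij ▸ hi)
      simp [prod_stepOp_single, hi, hij]

/-- The operators through which `Scyc (N + 3)` acts on the right. -/
noncomputable def stepOpFlip (x : Fin (N + 3)) : (Module.End K (ℕ →₀ K))ᵐᵒᵖ :=
  MulOpposite.op (stepOp N K x.rev)

lemma prod_stepOpFlip (w : List (Fin (N + 3))) :
    (w.map (stepOpFlip N K)).prod = MulOpposite.op ((revFlip w).map (stepOp N K)).prod := by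
  refine MulOpposite.unop_injective ?_
  rw [MulOpposite.unop_list_prod, MulOpposite.unop_op, revFlip, List.map_reverse, List.map_map,
    List.map_map]
  rfl

end Functional

end CyclicMonoid

open CyclicMonoid in
/-- the quotient ring `K[S_n]/K[P]` (the quotient of `K[S_n]` by the ring
congruence determined by the two-sided ideal `K[P]`, where `P = (a_1 ⋯ a_n) S_n`) is both
left and right primitive: it has a faithful simple left module and a faithful simple
right module (a module over the opposite ring). -/
theorem quotient_by_KP_primitive.{u} (K : Type u) [Field K] (n : ℕ) (hn : 3 ≤ n)
    (KP : Submodule K (MonoidAlgebra K (Scyc n)))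
    (hKP : KP = Submodule.span K (MonoidAlgebra.of K (Scyc n) '' {x | ∃ s, x = zc n * s}))
    (c : RingCon (MonoidAlgebra K (Scyc n)))
    (hc : c = ringConGen (fun x y => x - y ∈ KP)) :
    (∃ (V : Type u) (_ : AddCommGroup V) (_ : Module c.Quotient V),
        IsSimpleModule c.Quotient V ∧ FaithfulSMul c.Quotient V) ∧
    (∃ (V : Type u) (_ : AddCommGroup V) (_ : Module (c.Quotient)ᵐᵒᵖ V),
        IsSimpleModule (c.Quotient)ᵐᵒᵖ V ∧ FaithfulSMul (c.Quotient)ᵐᵒᵖ V) := by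
  obtain ⟨N, rfl⟩ := Nat.exists_eq_add_of_le' hn
  constructor
  · obtain ⟨f, hf, hK, hx⟩ := exists_quotient_ringHom (stepOp N K) (prod_stepOp_asc N K)
      (exists_functional N K) hKP hc
    exact exists_simple_faithful N K f hf hK hx
  · obtain ⟨f, hf, hK, hx⟩ := exists_quotient_ringHom (K := K) (stepOpFlip N K)
      (fun w hw hl => by
        rw [prod_stepOpFlip, prod_stepOp_asc N K _ hw.revFlip (by rw [length_revFlip, hl]),
          MulOpposite.op_zero])
      (fun w hw => by
        obtain ⟨l, hl, hl'⟩ := exists_functional N K _ hw.revFlip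
        refine ⟨l ∘ₗ (MulOpposite.opLinearEquiv K).symm.toLinearMap, ?_, fun v hv hne => ?_⟩
        · simpa [prod_stepOpFlip] using hl
        · simpa [prod_stepOpFlip] using hl' (revFlip v) (by simpa [length_revFlip] using hv)
            fun h => hne (by rw [← revFlip_revFlip v, h, revFlip_revFlip])) hKP hc
    refine exists_simple_faithful N K
      ((RingEquiv.opOp _).symm.toRingHom.comp (RingHom.op f)) ?_ (fun r => ?_) fun x => ?_
    · exact (RingEquiv.opOp _).symm.injective.comp
        (MulOpposite.op_injective.comp (hf.comp MulOpposite.unop_injective))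
    · obtain ⟨y, hy⟩ := hK r
      exact ⟨MulOpposite.op y, congrArg MulOpposite.unop hy⟩
    · obtain ⟨y, hy⟩ := hx x.rev
      refine ⟨MulOpposite.op y, (congrArg MulOpposite.unop hy).trans ?_⟩
      simp [stepOpFlip]
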